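/- For every permutation σ of {1,…,n} and all bounded functions Φ, Θ : S^n → ℂ, ⟨(T^V(σ) D^V(Φ)) ∘ D^V(Θ) Ξ, Ξ⟩ = ⟨D^V(Θ) ∘ (T^V(σ) D^V(Φ)) Ξ, Ξ⟩. -/

import Mathlib

noncomputable section

/-- The set of nonzero integers. -/
abbrev Sz : Type := {i : ℤ // i ≠ 0}

/-- The Hilbert space `ℓ²(S^n × S^n; ℂ)`. -/
abbrev HVW (n : ℕ) : Type := lp (fun _ : (Fin n → Sz) × (Fin n → Sz) => ℂ) 2

/-- Canonical orthonormal basis vectors `e_{I,J}`. -/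
def eVW {n : ℕ} (I J : Fin n → Sz) : HVW n := lp.single 2 (I, J) (1 : ℂ)

/-- The unit vector `Ξ = ∑_I (∏_k a(I_k))^{1/2} e_{I,I}`. -/
def Xi (n : ℕ) (a : Sz → ℝ) : HVW n :=
  ∑' I : Fin n → Sz, (Real.sqrt (∏ k, a (I k)) : ℂ) • eVW I I

/-!
STATEMENT 6: `⟨(T^V(σ) D^V(Φ)) ∘ D^V(Θ) Ξ, Ξ⟩ = ⟨D^V(Θ) ∘ (T^V(σ) D^V(Φ)) Ξ, Ξ⟩` for every
permutation σ and bounded Φ, Θ : S^n → ℂ.  (Mathlib's inner product is conjugate-linear in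
the first variable, so the paper's `⟨A Ξ, Ξ⟩` is rendered as `inner Ξ (A Ξ)`.)
-/

/-- The vector `Ξ` is supported on the diagonal. -/
theorem Xi_apply_of_ne {n : ℕ} (a : Sz → ℝ) {I J : Fin n → Sz} (h : I ≠ J) :
    Xi n a (I, J) = 0 := by
  unfold Xi
  by_cases hs : Summable fun K : Fin n → Sz => (Real.sqrt (∏ k, a (K k)) : ℂ) • eVW K K
  · have hsum := (lp.evalCLM ℂ (fun _ : (Fin n → Sz) × (Fin n → Sz) => ℂ) 2 (I, J)).map_tsum hs
    refine hsum.trans ((tsum_congr fun K => ?_).trans tsum_zero)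
    have hne : (I, J) ≠ (K, K) := by
      rintro ⟨⟩
      exact h rfl
    have hz : eVW K K (I, J) = 0 := lp.single_apply_ne 2 (K, K) 1 hne
    change (Real.sqrt (∏ k, a (K k)) : ℂ) * eVW K K (I, J) = 0
    rw [hz, mul_zero]
  · rw [tsum_eq_zero_of_not_summable hs]
    rfl

theorem TD_commutes_with_diagonal_in_trace (n : ℕ) (a : Sz → ℝ)
    (ha : ∀ i, 0 ≤ a i) (hsum : HasSum a 1)
    (σ : Equiv.Perm (Fin n)) (Φ Θ : (Fin n → Sz) → ℂ)
    (hΦ : ∃ C : ℝ, ∀ I, ‖Φ I‖ ≤ C)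
    (hΘ : ∃ C : ℝ, ∀ I, ‖Θ I‖ ≤ C)
    (T DΦ DΘ : HVW n →L[ℂ] HVW n)
    (hT : ∀ (f : HVW n) (I J : Fin n → Sz), (T f) (I, J) = f (I ∘ σ, J))
    (hDΦ : ∀ (f : HVW n) (I J : Fin n → Sz), (DΦ f) (I, J) = Φ I * f (I, J))
    (hDΘ : ∀ (f : HVW n) (I J : Fin n → Sz), (DΘ f) (I, J) = Θ I * f (I, J)) :
    (inner ℂ (Xi n a) (T (DΦ (DΘ (Xi n a)))) : ℂ) =
      inner ℂ (Xi n a) (DΘ (T (DΦ (Xi n a)))) := by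
  rw [lp.inner_eq_tsum, lp.inner_eq_tsum]
  refine tsum_congr ?_
  rintro ⟨I, J⟩
  rw [hT, hDΦ, hDΘ, hDΘ, hT, hDΦ]
  by_cases hIJ : I = J
  · by_cases hσ : I ∘ σ = J
    · rw [hσ, hIJ, mul_left_comm]
    · simp [Xi_apply_of_ne a hσ]
  · simp [Xi_apply_of_ne a hIJ]
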